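/- arXiv:0711.4179 — 7 statements merged into one kernel-verified Lean document; each statement's English description precedes it below -/
import Mathlib

section
/- Let A be an n×n doubly stochastic matrix and let w_{ij} denote the (i,j)-th entry of AᵀA. Then for every vector x ∈ ℝⁿ, V(Ax) = V(x) − Σ_{i<j} w_{ij} (x_i − x_j)², where the sum is over all pairs 1 ≤ i < j ≤ n. -/
open Matrix Finset Real Filter

/-- A matrix is doubly stochastic if entrywise nonnegative with all rows and columns summing to 1. -/
def IsDoublyStochastic {n : ℕ} (A : Matrix (Fin n) (Fin n) ℝ) : Prop :=
  (∀ i j, 0 ≤ A i j) ∧ (∀ i, ∑ j, A i j = 1) ∧ (∀ j, ∑ i, A i j = 1)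

/-- The average of the components of a vector. -/
noncomputable def avgVec {n : ℕ} (x : Fin n → ℝ) : ℝ := (∑ i, x i) / n

/-- The sample variance V(x) = Σ_i (x_i - x̄)². -/
noncomputable def sampleVar {n : ℕ} (x : Fin n → ℝ) : ℝ := ∑ i, (x i - avgVec x) ^ 2

/-- The Lyapunov function V̲(x) = Σ_i (x_i - min_j x_j)². -/
noncomputable def underVar {n : ℕ} (x : Fin n → ℝ) : ℝ := ∑ i, (x i - ⨅ j, x j) ^ 2

/-- Σ_{i=1}^{n-1} (x_i - x_{i+1})² for a vector indexed by `Fin n`. -/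
noncomputable def sumSqDiff {n : ℕ} (x : Fin n → ℝ) : ℝ :=
  ∑ i : Fin n, if h : (i : ℕ) + 1 < n then (x i - x ⟨(i : ℕ) + 1, h⟩) ^ 2 else 0

/-- Rounding down to the nearest multiple of 1/Q. -/
noncomputable def qfloor (Q : ℕ) (y : ℝ) : ℝ := (⌊(Q : ℝ) * y⌋ : ℝ) / Q

/-- Doubly stochastic with positive diagonal and all positive entries at least η. -/
def GoodWeights {n : ℕ} (η : ℝ) (A : Matrix (Fin n) (Fin n) ℝ) : Prop :=
  IsDoublyStochastic A ∧ (∀ i, 0 < A i i) ∧ ∀ i j, 0 < A i j → η ≤ A i j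

/-- The directed graph with edges `E(A(kB)) ∪ ⋯ ∪ E(A((k+1)B-1))` is strongly connected;
here `(j,i) ∈ E(A)` iff `A i j > 0`. -/
def BlockConnected {n : ℕ} (A : ℕ → Matrix (Fin n) (Fin n) ℝ) (B k : ℕ) : Prop :=
  ∀ u v : Fin n,
    Relation.ReflTransGen (fun a b => ∃ t, k * B ≤ t ∧ t < (k + 1) * B ∧ 0 < A t b a) u v

/-- Assumption 3 of the paper for the (already sorted) vector `y = x(kB)`: for every cut `d`,
either the d-th and (d+1)-th components are equal, or some edge crosses the cut during
the time block `[kB, (k+1)B)`. -/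
def CutCondition {n : ℕ} (A : ℕ → Matrix (Fin n) (Fin n) ℝ) (B k : ℕ) (y : Fin n → ℝ) : Prop :=
  ∀ d : Fin n, ∀ h : (d : ℕ) + 1 < n,
    y d = y ⟨(d : ℕ) + 1, h⟩ ∨
      ∃ t, k * B ≤ t ∧ t < (k + 1) * B ∧
        ∃ i j : Fin n, i ≤ d ∧ d < j ∧ (0 < A t i j ∨ 0 < A t j i)

/-- Assumption 3 of the paper at time block `k`: after reordering the components of `x`
in nonincreasing order via a permutation `σ`, for every cut `d`, either the d-th and
(d+1)-th ordered components are equal, or some edge crossing the cut appears during the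
time block `[kB, (k+1)B)`. -/
def CutConditionPerm {n : ℕ} (A : ℕ → Matrix (Fin n) (Fin n) ℝ) (B k : ℕ)
    (x : Fin n → ℝ) : Prop :=
  ∃ σ : Equiv.Perm (Fin n), Antitone (x ∘ σ) ∧
    ∀ d : Fin n, ∀ h : (d : ℕ) + 1 < n,
      x (σ d) = x (σ ⟨(d : ℕ) + 1, h⟩) ∨
        ∃ t, k * B ≤ t ∧ t < (k + 1) * B ∧
          ∃ i j : Fin n, i ≤ d ∧ d < j ∧ (0 < A t (σ i) (σ j) ∨ 0 < A t (σ j) (σ i))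

theorem aux_sym {n : ℕ} (f : Fin n → Fin n → ℝ) (hs : ∀ i j, f i j = f j i)
    (h0 : ∀ i, f i i = 0) :
    ∑ i, ∑ j, f i j = 2 * ∑ i : Fin n, ∑ j ∈ Finset.Ioi i, f i j := by
  have h1 : ∀ i : Fin n, ∑ j ∈ Finset.Ioi i, f i j = ∑ j, if i < j then f i j else 0 := by
    intro i
    rw [← Finset.sum_filter]
    congr 1
    ext j
    simp
  simp only [h1]
  have h2 : ∑ i : Fin n, ∑ j, (if i < j then f i j else 0)
      = ∑ i : Fin n, ∑ j, (if j < i then f i j else 0) := by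
    rw [Finset.sum_comm]
    refine Finset.sum_congr rfl fun i _ => Finset.sum_congr rfl fun j _ => ?_
    rw [hs]
  rw [two_mul]
  nth_rewrite 2 [h2]
  simp only [← Finset.sum_add_distrib]
  refine Finset.sum_congr rfl fun i _ => Finset.sum_congr rfl fun j _ => ?_
  rcases lt_trichotomy i j with h | h | h
  · simp [h, h.not_gt]
  · subst h
    simp [h0]
  · simp [h, h.not_gt]

theorem aux_var {n : ℕ} (x : Fin n → ℝ) :
    sampleVar x = ∑ i, x i ^ 2 - 2 * avgVec x * ∑ i, x i + n * avgVec x ^ 2 := by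
  unfold sampleVar
  simp only [sub_sq, Finset.sum_add_distrib, Finset.sum_sub_distrib, Finset.mul_sum]
  simp
  refine Finset.sum_congr rfl fun i _ => ?_
  ring

/-- For a doubly stochastic matrix `A` with `w = AᵀA`,
`V(Ax) = V(x) - Σ_{i<j} w_{ij} (x_i - x_j)²`. -/
theorem stmt0 {n : ℕ} (A : Matrix (Fin n) (Fin n) ℝ) (hA : IsDoublyStochastic A)
    (x : Fin n → ℝ) :
    sampleVar (A.mulVec x) =
      sampleVar x - ∑ i : Fin n, ∑ j ∈ Finset.Ioi i, (Aᵀ * A) i j * (x i - x j) ^ 2 := by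
  obtain ⟨-, hr, hc⟩ := hA
  have hsum : ∑ i, (A.mulVec x) i = ∑ i, x i := by
    simp only [Matrix.mulVec, dotProduct]
    rw [Finset.sum_comm]
    simp only [← Finset.sum_mul, hc, one_mul]
  have hw : ∀ i j, (Aᵀ * A) i j = (Aᵀ * A) j i := by
    intro i j
    simp only [Matrix.mul_apply, Matrix.transpose_apply, mul_comm]
  have hw1 : ∀ i, ∑ j, (Aᵀ * A) i j = 1 := by
    intro i
    simp only [Matrix.mul_apply, Matrix.transpose_apply]
    rw [Finset.sum_comm]
    simp only [← Finset.mul_sum, hr, mul_one, hc]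
  have hq : ∑ i, ∑ j, (Aᵀ * A) i j * (x i * x j) = ∑ k, (A.mulVec x) k ^ 2 := by
    simp only [Matrix.mulVec, dotProduct, sq, Matrix.mul_apply,
      Matrix.transpose_apply, Finset.sum_mul]
    rw [Finset.sum_comm' (t' := Finset.univ) (s' := fun _ => Finset.univ) (by simp)]
    rw [Finset.sum_congr rfl fun i _ => Finset.sum_comm]
    rw [Finset.sum_comm]
    refine Finset.sum_congr rfl fun k _ => ?_
    rw [Finset.sum_comm]
    refine Finset.sum_congr rfl fun i _ => ?_
    rw [Finset.mul_sum]
    refine Finset.sum_congr rfl fun j _ => ?_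
    ring
  have hd := aux_sym (fun i j => (Aᵀ * A) i j * (x i - x j) ^ 2)
    (fun i j => by rw [hw i j]; ring) (fun i => by simp)
  have he : ∑ i, ∑ j, (Aᵀ * A) i j * (x i - x j) ^ 2
      = ∑ i, ∑ j, (Aᵀ * A) i j * x i ^ 2 + ∑ i, ∑ j, (Aᵀ * A) i j * x j ^ 2
        - 2 * ∑ i, ∑ j, (Aᵀ * A) i j * (x i * x j) := by
    simp only [Finset.mul_sum, ← Finset.sum_add_distrib, ← Finset.sum_sub_distrib]
    refine Finset.sum_congr rfl fun i _ => Finset.sum_congr rfl fun j _ => ?_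
    ring
  have h3 : ∑ i, ∑ j, (Aᵀ * A) i j * x i ^ 2 = ∑ i, x i ^ 2 := by
    simp only [← Finset.sum_mul, hw1, one_mul]
  have h4 : ∑ i, ∑ j, (Aᵀ * A) i j * x j ^ 2 = ∑ i, x i ^ 2 := by
    rw [← h3, Finset.sum_comm]
    refine Finset.sum_congr rfl fun i _ => Finset.sum_congr rfl fun j _ => ?_
    rw [hw]
  have havg : avgVec (A.mulVec x) = avgVec x := by
    unfold avgVec
    rw [hsum]
  rw [aux_var, aux_var, havg, hsum]
  linarith
end

section
/- Let A be an n×n row-stochastic matrix with positive diagonal entries whose smallest positive entry is at least η > 0, and let w_{ij} denote the (i,j)-th entry of AᵀA. Let (S⁻, S⁺) be a partition of {1,…,n} into two disjoint nonempty sets. If Σ_{i ∈ S⁻, j ∈ S⁺} w_{ij} > 0, then Σ_{i ∈ S⁻, j ∈ S⁺} w_{ij} ≥ η/2. -/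
open Matrix Finset Real Filter

/-- For a row-stochastic matrix `A` with positive diagonal whose smallest
positive entry is at least `η`, and a partition `(S⁻, S⁺)` of the index set, if
`Σ_{i ∈ S⁻, j ∈ S⁺} w_{ij} > 0` then `Σ_{i ∈ S⁻, j ∈ S⁺} w_{ij} ≥ η/2`, where `w = AᵀA`. -/
theorem stmt2 {n : ℕ} (η : ℝ) (hη : 0 < η) (A : Matrix (Fin n) (Fin n) ℝ)
    (hnn : ∀ i j, 0 ≤ A i j) (hrow : ∀ i, ∑ j, A i j = 1)
    (hdiag : ∀ i, 0 < A i i) (hpos : ∀ i j, 0 < A i j → η ≤ A i j)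
    (Sm Sp : Finset (Fin n)) (hdisj : Disjoint Sm Sp) (hunion : Sm ∪ Sp = Finset.univ)
    (hSm : Sm.Nonempty) (hSp : Sp.Nonempty)
    (hsum : 0 < ∑ i ∈ Sm, ∑ j ∈ Sp, (Aᵀ * A) i j) :
    η / 2 ≤ ∑ i ∈ Sm, ∑ j ∈ Sp, (Aᵀ * A) i j := by
  have key : ∑ i ∈ Sm, ∑ j ∈ Sp, (Aᵀ * A) i j
      = ∑ k, (∑ i ∈ Sm, A k i) * (∑ j ∈ Sp, A k j) := by
    simp only [Matrix.mul_apply, Matrix.transpose_apply, Finset.sum_mul_sum]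
    rw [Finset.sum_comm]
    simp_rw [Finset.sum_comm (s := Sm)]
    rw [Finset.sum_comm]
  rw [key] at hsum ⊢
  have hM : ∀ k, 0 ≤ ∑ i ∈ Sm, A k i := fun k => Finset.sum_nonneg fun i _ => hnn k i
  have hP : ∀ k, 0 ≤ ∑ i ∈ Sp, A k i := fun k => Finset.sum_nonneg fun i _ => hnn k i
  have hlow : ∀ (S : Finset (Fin n)) k, 0 < ∑ i ∈ S, A k i → η ≤ ∑ i ∈ S, A k i := by
    intro S k h
    obtain ⟨i, hi, hi0⟩ := Finset.exists_lt_of_sum_lt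
      (s := S) (f := fun _ => (0 : ℝ)) (g := fun i => A k i) (by simpa using h)
    exact (hpos k i hi0).trans
      (Finset.single_le_sum (f := fun i => A k i) (fun i _ => hnn k i) hi)
  obtain ⟨k, -, hk⟩ := Finset.exists_lt_of_sum_lt
    (s := Finset.univ) (f := fun _ : Fin n => (0 : ℝ))
    (g := fun k => (∑ i ∈ Sm, A k i) * (∑ j ∈ Sp, A k j)) (by simpa using hsum)
  have h1 : ∑ i ∈ Sm, A k i + ∑ i ∈ Sp, A k i = 1 := by
    rw [← Finset.sum_union hdisj, hunion, hrow]
  refine le_trans ?_ (Finset.single_le_sum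
    (f := fun k => (∑ i ∈ Sm, A k i) * (∑ j ∈ Sp, A k j))
    (fun i _ => mul_nonneg (hM i) (hP i)) (Finset.mem_univ k))
  have hk' : 0 < (∑ i ∈ Sm, A k i) * (∑ j ∈ Sp, A k j) := hk
  have hm := hlow Sm k (pos_of_mul_pos_left hk' (hP k))
  have hp := hlow Sp k (pos_of_mul_pos_right hk' (hM k))
  show η / 2 ≤ (∑ i ∈ Sm, A k i) * (∑ j ∈ Sp, A k j)
  generalize ∑ i ∈ Sm, A k i = m at *
  generalize ∑ i ∈ Sp, A k i = p at *
  rcases le_total m p with h | h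
  · nlinarith
  · nlinarith
end

section
/- Let η > 0 and B ≥ 1, and let A(k), k ≥ 0, be a sequence of n×n doubly stochastic matrices with positive diagonal entries whose positive entries are all at least η. Let x(k+1) = A(k)x(k) for all k, and assume that for every k, after reordering the components of x(kB) in nonincreasing order, for every d ∈ {1,…,n−1} either the d-th and (d+1)-th ordered components of x(kB) are equal, or there exist a time t ∈ {kB,…,(k+1)B−1} and indices i among the d largest-valued nodes and j among the rest such that (i,j) or (j,i) belongs to E(A(t)). If V(x(kB)) > 0, then (V(x(kB)) − V(x((k+1)B))) / V(x(kB)) ≥ η/(2n²). -/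
open Matrix Finset Real Filter

theorem row_var {n : ℕ} (p x : Fin n → ℝ) (hp : ∑ i, p i = 1) :
    ∑ i, p i * x i ^ 2 - (∑ i, p i * x i) ^ 2 =
      (1 / 2) * ∑ i, ∑ j, p i * p j * (x i - x j) ^ 2 := by
  have h1 : ∀ i, ∑ j, p i * p j * (x i - x j) ^ 2 =
      p i * x i ^ 2 * (∑ j, p j) - 2 * (p i * x i) * (∑ j, p j * x j)
        + p i * ∑ j, p j * x j ^ 2 := by
    intro i
    rw [Finset.mul_sum, Finset.mul_sum, Finset.mul_sum, ← Finset.sum_sub_distrib,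
      ← Finset.sum_add_distrib]
    exact Finset.sum_congr rfl fun j _ => by ring
  simp_rw [h1]
  rw [Finset.sum_add_distrib, Finset.sum_sub_distrib, ← Finset.sum_mul, ← Finset.sum_mul,
    ← Finset.sum_mul, ← Finset.mul_sum, hp]
  ring

theorem sampleVar_eq {n : ℕ} (x : Fin n → ℝ) :
    sampleVar x = ∑ i, x i ^ 2 - (∑ i, x i) ^ 2 / n := by
  unfold sampleVar avgVec
  rcases Nat.eq_zero_or_pos n with h | h
  · subst h; simp
  have hn : (n : ℝ) ≠ 0 := by positivity
  have : ∀ i, (x i - (∑ i, x i) / n) ^ 2 =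
      x i ^ 2 - 2 * ((∑ i, x i) / n) * x i + ((∑ i, x i) / n) ^ 2 := fun i => by ring
  simp_rw [this]
  rw [Finset.sum_add_distrib, Finset.sum_sub_distrib, ← Finset.mul_sum]
  simp
  field_simp
  ring

theorem sampleVar_le {n : ℕ} (x : Fin n → ℝ) (hn : 0 < n) (c : ℝ) :
    sampleVar x ≤ ∑ i, (x i - c) ^ 2 := by
  rw [sampleVar_eq]
  have hn : (0 : ℝ) < n := by exact_mod_cast hn
  have : ∀ i, (x i - c) ^ 2 = x i ^ 2 - 2 * c * x i + c ^ 2 := fun i => by ring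
  simp_rw [this]
  rw [Finset.sum_add_distrib, Finset.sum_sub_distrib, ← Finset.mul_sum]
  simp
  have h : 0 ≤ (∑ i, x i - n * c) ^ 2 / n := by positivity
  have h2 : (∑ i, x i - n * c) ^ 2 / n = (∑ i, x i) ^ 2 / n - 2 * c * ∑ i, x i + n * c ^ 2 := by
    field_simp
    ring
  linarith

theorem var_drop {n : ℕ} (A : Matrix (Fin n) (Fin n) ℝ) (hA : IsDoublyStochastic A)
    (x : Fin n → ℝ) :
    sampleVar x - sampleVar (A.mulVec x) =
      ∑ k, (∑ j, A k j * x j ^ 2 - (∑ j, A k j * x j) ^ 2) := by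
  have hc : ∀ f : Fin n → ℝ, ∑ k, ∑ j, A k j * f j = ∑ j, f j := by
    intro f
    rw [Finset.sum_comm]
    refine Finset.sum_congr rfl fun j _ => ?_
    rw [← Finset.sum_mul, hA.2.2 j, one_mul]
  rw [sampleVar_eq, sampleVar_eq, Finset.sum_sub_distrib, hc]
  have : ∀ k, A.mulVec x k = ∑ j, A k j * x j := fun k => rfl
  simp_rw [this]
  rw [hc]
  ring

theorem gap_sum {Y : ℕ → ℝ} (hY : Antitone Y) (F : Finset ℕ) (a b : ℕ) (hab : a ≤ b)
    (hF : F ⊆ Finset.Ico a b) :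
    ∑ d ∈ F, (Y d - Y (d + 1)) ^ 2 ≤ (Y a - Y b) ^ 2 := by
  have hg : ∀ d, 0 ≤ Y d - Y (d + 1) := fun d => sub_nonneg.2 (hY (Nat.le_succ d))
  calc ∑ d ∈ F, (Y d - Y (d + 1)) ^ 2 ≤ (∑ d ∈ F, (Y d - Y (d + 1))) ^ 2 :=
        Finset.sum_sq_le_sq_sum_of_nonneg fun d _ => hg d
    _ ≤ (∑ d ∈ Finset.Ico a b, (Y d - Y (d + 1))) ^ 2 := by
        apply pow_le_pow_left₀ (Finset.sum_nonneg fun d _ => hg d)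
        exact Finset.sum_le_sum_of_subset_of_nonneg hF fun d _ _ => hg d
    _ = (Y a - Y b) ^ 2 := by
        have h := Finset.sum_Ico_sub Y hab
        have : ∑ d ∈ Finset.Ico a b, (Y d - Y (d + 1)) = Y a - Y b := by
          rw [← neg_inj, ← Finset.sum_neg_distrib]
          simpa using h
        rw [this]

/-- Indicator of the top set. -/
noncomputable def cInd {n : ℕ} (r : Fin n → ℕ) (d : ℕ) (i : Fin n) : ℝ := if r i ≤ d then 1 else 0

theorem row_bound {n : ℕ} (p x : Fin n → ℝ) (hp0 : ∀ i, 0 ≤ p i) (hp : ∑ i, p i = 1)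
    (r : Fin n → ℕ) (D : Finset ℕ) (g : ℕ → ℝ)
    (h : ∀ i j, ∑ d ∈ D, g d * (cInd r d i - cInd r d j) ^ 2 ≤ (x i - x j) ^ 2) :
    ∑ d ∈ D, g d * ((∑ i, p i * cInd r d i) * (1 - ∑ i, p i * cInd r d i)) ≤
      ∑ i, p i * x i ^ 2 - (∑ i, p i * x i) ^ 2 := by
  have h1 : ∀ d, (∑ i, p i * cInd r d i) * (1 - ∑ i, p i * cInd r d i) =
      (1 / 2) * ∑ i, ∑ j, p i * p j * (cInd r d i - cInd r d j) ^ 2 := by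
    intro d
    rw [← row_var p _ hp]
    have : ∀ i, cInd r d i ^ 2 = cInd r d i := by
      intro i; unfold cInd; split_ifs <;> norm_num
    simp_rw [this]
    ring
  rw [row_var p x hp]
  simp_rw [h1]
  calc ∑ d ∈ D, g d * ((1 / 2) * ∑ i, ∑ j, p i * p j * (cInd r d i - cInd r d j) ^ 2)
      = (1 / 2) * ∑ i, ∑ j, p i * p j * ∑ d ∈ D, g d * (cInd r d i - cInd r d j) ^ 2 := by
        simp_rw [Finset.mul_sum]
        rw [Finset.sum_comm]
        refine Finset.sum_congr rfl fun i _ => ?_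
        rw [Finset.sum_comm]
        refine Finset.sum_congr rfl fun j _ => ?_
        refine Finset.sum_congr rfl fun d _ => ?_
        ring
    _ ≤ _ := by
        refine mul_le_mul_of_nonneg_left ?_ (by norm_num)
        refine Finset.sum_le_sum fun i _ => Finset.sum_le_sum fun j _ => ?_
        exact mul_le_mul_of_nonneg_left (h i j) (mul_nonneg (hp0 i) (hp0 j))

/-- Some edge crosses the cut. -/
def Crosses {n : ℕ} (A : Matrix (Fin n) (Fin n) ℝ) (r : Fin n → ℕ) (d : ℕ) : Prop :=
  ∃ i j, r i ≤ d ∧ d < r j ∧ (0 < A i j ∨ 0 < A j i)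

theorem c_bounds {n : ℕ} (p : Fin n → ℝ) (hp0 : ∀ i, 0 ≤ p i) (hp : ∑ i, p i = 1)
    (r : Fin n → ℕ) (d : ℕ) :
    (∀ i, r i ≤ d → p i ≤ ∑ i, p i * cInd r d i) ∧
    (∀ i, d < r i → p i ≤ 1 - ∑ i, p i * cInd r d i) := by
  constructor
  · intro i hi
    have := Finset.single_le_sum (f := fun i => p i * cInd r d i) (s := Finset.univ)
      (fun i _ => mul_nonneg (hp0 i) (by unfold cInd; split_ifs <;> norm_num)) (Finset.mem_univ i)
    simpa [cInd, hi] using this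
  · intro i hi
    have := Finset.single_le_sum (f := fun i => p i * (1 - cInd r d i)) (s := Finset.univ)
      (fun i _ => mul_nonneg (hp0 i) (by unfold cInd; split_ifs <;> norm_num)) (Finset.mem_univ i)
    simp only [mul_sub, mul_one, Finset.sum_sub_distrib, hp] at this
    simpa [cInd, not_le.2 hi] using this

theorem half_bound {η C : ℝ} (hη : 0 < η) (h1 : η ≤ C) (h2 : η ≤ 1 - C) :
    η / 2 ≤ C * (1 - C) := by
  rcases le_total C (1 / 2) with h | h <;> nlinarith

theorem cross_weight {n : ℕ} {η : ℝ} (hη : 0 < η) (A : Matrix (Fin n) (Fin n) ℝ)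
    (hA : GoodWeights η A) (r : Fin n → ℕ) (d : ℕ) (hc : Crosses A r d) :
    η / 2 ≤ ∑ k, (∑ i, A k i * cInd r d i) * (1 - ∑ i, A k i * cInd r d i) := by
  obtain ⟨⟨h0, hr, -⟩, hd, hpos⟩ := hA
  have hb := fun k => c_bounds (A k) (h0 k) (hr k) r d
  have hC : ∀ k, 0 ≤ ∑ i, A k i * cInd r d i := fun k =>
    Finset.sum_nonneg fun i _ => mul_nonneg (h0 k i) (by unfold cInd; split_ifs <;> norm_num)
  have hC1 : ∀ k, 0 ≤ 1 - ∑ i, A k i * cInd r d i := fun k => by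
    rw [← hr k, ← Finset.sum_sub_distrib]
    exact Finset.sum_nonneg fun i _ => by
      have := h0 k i
      unfold cInd; split_ifs <;> simp [this]
  obtain ⟨i, j, hi, hj, hij⟩ := hc
  have key : ∃ k, η ≤ ∑ i, A k i * cInd r d i ∧ η ≤ 1 - ∑ i, A k i * cInd r d i := by
    rcases hij with h | h
    · exact ⟨i, (hpos _ _ (hd i)).trans ((hb i).1 i hi), (hpos _ _ h).trans ((hb i).2 j hj)⟩
    · exact ⟨j, (hpos _ _ h).trans ((hb j).1 i hi), (hpos _ _ (hd j)).trans ((hb j).2 j hj)⟩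
  obtain ⟨k, hk1, hk2⟩ := key
  exact (half_bound hη hk1 hk2).trans
    (Finset.single_le_sum (f := fun k => (∑ i, A k i * cInd r d i) * (1 - ∑ i, A k i * cInd r d i))
      (fun k _ => mul_nonneg (hC k) (hC1 k)) (Finset.mem_univ k))

theorem step_drop {n : ℕ} {η : ℝ} (hη : 0 < η) (A : Matrix (Fin n) (Fin n) ℝ)
    (hA : GoodWeights η A) (x : Fin n → ℝ) (r : Fin n → ℕ) (Y : ℕ → ℝ) (hY : Antitone Y)
    (D : Finset ℕ) (hD : ∀ d ∈ D, Crosses A r d)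
    (hx : ∀ d ∈ D, ∀ i, (r i ≤ d → Y d ≤ x i) ∧ (d < r i → x i ≤ Y (d + 1))) :
    η / 2 * ∑ d ∈ D, (Y d - Y (d + 1)) ^ 2 ≤ sampleVar x - sampleVar (A.mulVec x) := by
  have hpair : ∀ i j, r i ≤ r j →
      ∑ d ∈ D, (Y d - Y (d + 1)) ^ 2 * (cInd r d i - cInd r d j) ^ 2 ≤ (x i - x j) ^ 2 := by
    intro i j hij
    have e : ∑ d ∈ D, (Y d - Y (d + 1)) ^ 2 * (cInd r d i - cInd r d j) ^ 2 =
        ∑ d ∈ D.filter (fun d => r i ≤ d ∧ d < r j), (Y d - Y (d + 1)) ^ 2 := by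
      rw [Finset.sum_filter]
      refine Finset.sum_congr rfl fun d _ => ?_
      unfold cInd
      by_cases h1 : r i ≤ d <;> by_cases h2 : r j ≤ d
      · simp [h1, h2, not_lt.2 h2]
      · simp [h1, h2, not_le.1 h2]
      · omega
      · simp [h1, h2]
    rw [e]
    set F := D.filter (fun d => r i ≤ d ∧ d < r j) with hF
    rcases F.eq_empty_or_nonempty with hE | hE
    · rw [hE]; simp; positivity
    have m1 := Finset.mem_filter.1 (F.min'_mem hE)
    have m2 := Finset.mem_filter.1 (F.max'_mem hE)
    have hle : F.min' hE ≤ F.max' hE := F.min'_le _ (F.max'_mem hE)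
    have a1 := (hx _ m1.1 i).1 m1.2.1
    have a2 := (hx _ m2.1 j).2 m2.2.2
    have a3 := hY (show F.min' hE ≤ F.max' hE + 1 by omega)
    refine (gap_sum hY F (F.min' hE) (F.max' hE + 1) (by omega) ?_).trans ?_
    · intro d hd
      rw [Finset.mem_Ico]
      exact ⟨F.min'_le _ hd, Nat.lt_succ_of_le (F.le_max' _ hd)⟩
    · apply pow_le_pow_left₀ <;> linarith
  have hpair' : ∀ i j,
      ∑ d ∈ D, (Y d - Y (d + 1)) ^ 2 * (cInd r d i - cInd r d j) ^ 2 ≤ (x i - x j) ^ 2 := by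
    intro i j
    rcases le_total (r i) (r j) with h | h
    · exact hpair i j h
    · have := hpair j i h
      rw [sub_sq_comm (x i)]
      simpa only [sub_sq_comm (cInd r _ i)] using this
  rw [var_drop A hA.1]
  calc η / 2 * ∑ d ∈ D, (Y d - Y (d + 1)) ^ 2
      ≤ ∑ d ∈ D, (Y d - Y (d + 1)) ^ 2 *
        ∑ k, (∑ i, A k i * cInd r d i) * (1 - ∑ i, A k i * cInd r d i) := by
        rw [Finset.mul_sum]
        refine Finset.sum_le_sum fun d hd => ?_
        rw [mul_comm]
        exact mul_le_mul_of_nonneg_left (cross_weight hη A hA r d (hD d hd)) (sq_nonneg _)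
    _ = ∑ k, ∑ d ∈ D, (Y d - Y (d + 1)) ^ 2 *
        ((∑ i, A k i * cInd r d i) * (1 - ∑ i, A k i * cInd r d i)) := by
        rw [Finset.sum_comm]
        exact Finset.sum_congr rfl fun d _ => Finset.mul_sum _ _ _
    _ ≤ _ := Finset.sum_le_sum fun k _ =>
        row_bound (A k) x (hA.1.1 k) (hA.1.2.1 k) r D _ hpair'

theorem invariant {n : ℕ} {η : ℝ}
    (A : ℕ → Matrix (Fin n) (Fin n) ℝ) (hA : ∀ k, GoodWeights η (A k))
    (x : ℕ → Fin n → ℝ) (hx : ∀ k, x (k + 1) = (A k).mulVec (x k)) (r : Fin n → ℕ)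
    (d t0 : ℕ) (a b : ℝ)
    (h0 : ∀ i, (r i ≤ d → a ≤ x t0 i) ∧ (d < r i → x t0 i ≤ b)) (t : ℕ) (ht : t0 ≤ t) :
    (∀ s, t0 ≤ s → s < t → ¬ Crosses (A s) r d) →
      ∀ i, (r i ≤ d → a ≤ x t i) ∧ (d < r i → x t i ≤ b) := by
  induction t, ht using Nat.le_induction with
  | base => intro _; exact h0
  | succ t ht ih =>
    intro hs i
    have ih := ih fun s h1 h2 => hs s h1 (by omega)
    have hc := hs t ht (by omega)
    obtain ⟨⟨hn, hr, -⟩, -, -⟩ := hA t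
    have e : x (t + 1) i = ∑ j, A t i j * x t j := by rw [hx]; rfl
    rw [e]
    constructor
    · intro hi
      have : a = ∑ j, A t i j * a := by rw [← Finset.sum_mul, hr, one_mul]
      rw [this]
      refine Finset.sum_le_sum fun j _ => ?_
      by_cases hj : r j ≤ d
      · exact mul_le_mul_of_nonneg_left ((ih j).1 hj) (hn i j)
      · have : A t i j = 0 := le_antisymm (not_lt.1 fun h =>
          hc ⟨i, j, hi, not_le.1 hj, Or.inl h⟩) (hn i j)
        simp [this]
    · intro hi
      have : b = ∑ j, A t i j * b := by rw [← Finset.sum_mul, hr, one_mul]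
      rw [this]
      refine Finset.sum_le_sum fun j _ => ?_
      by_cases hj : r j ≤ d
      · have : A t i j = 0 := le_antisymm (not_lt.1 fun h =>
          hc ⟨j, i, hj, hi, Or.inr h⟩) (hn i j)
        simp [this]
      · exact mul_le_mul_of_nonneg_left ((ih j).2 (not_le.1 hj)) (hn i j)

/-- Under the standing assumptions, if `V(x(kB)) > 0` then
`(V(x(kB)) - V(x((k+1)B))) / V(x(kB)) ≥ η/(2n²)`. -/
theorem stmt5 {n : ℕ} (η : ℝ) (hη : 0 < η) (B : ℕ) (hB : 1 ≤ B)
    (A : ℕ → Matrix (Fin n) (Fin n) ℝ) (hA : ∀ k, GoodWeights η (A k))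
    (x : ℕ → Fin n → ℝ) (hx : ∀ k, x (k + 1) = (A k).mulVec (x k))
    (hcut : ∀ k, CutConditionPerm A B k (x (k * B)))
    (k : ℕ) (hV : 0 < sampleVar (x (k * B))) :
    η / (2 * (n : ℝ) ^ 2) ≤
      (sampleVar (x (k * B)) - sampleVar (x ((k + 1) * B))) / sampleVar (x (k * B)) := by
  classical
  have hn : 0 < n := by
    rcases Nat.eq_zero_or_pos n with h | h
    · subst h; simp [sampleVar] at hV
    · exact h
  obtain ⟨σ, hσ, hc⟩ := hcut k
  set t0 := k * B with ht0
  set t1 := (k + 1) * B with ht1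
  have h01 : t0 ≤ t1 := Nat.mul_le_mul_right _ (Nat.le_succ k)
  let r : Fin n → ℕ := fun i => (σ.symm i : ℕ)
  let Y : ℕ → ℝ := fun m => x t0 (σ ⟨min m (n - 1), by omega⟩)
  have hY : Antitone Y := by
    intro a b hab
    apply hσ
    show min a (n - 1) ≤ min b (n - 1)
    omega
  have hYr : ∀ i, x t0 i = Y (r i) := by
    intro i
    have : (⟨min (r i) (n - 1), by omega⟩ : Fin n) = σ.symm i := by
      apply Fin.ext
      have : r i < n := (σ.symm i).2
      show min (r i) (n - 1) = r i
      omega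
    show _ = x t0 (σ ⟨min (r i) (n - 1), _⟩)
    rw [this]; simp
  let D : ℕ → Finset ℕ := fun t => (Finset.range (n - 1)).filter fun d =>
    Crosses (A t) r d ∧ ∀ s, t0 ≤ s → s < t → ¬ Crosses (A s) r d
  have hstep : ∀ t ∈ Finset.Ico t0 t1, η / 2 * ∑ d ∈ D t, (Y d - Y (d + 1)) ^ 2 ≤
      sampleVar (x t) - sampleVar (x (t + 1)) := by
    intro t ht
    rw [hx t]
    refine step_drop hη (A t) (hA t) (x t) r Y hY (D t)
      (fun d hd => (Finset.mem_filter.1 hd).2.1) fun d hd => ?_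
    refine invariant A hA x hx r d t0 _ _ (fun i => ?_) t (Finset.mem_Ico.1 ht).1
      (Finset.mem_filter.1 hd).2.2
    rw [hYr]
    exact ⟨fun h => hY h, fun h => hY h⟩
  have htot : η / 2 * ∑ t ∈ Finset.Ico t0 t1, ∑ d ∈ D t, (Y d - Y (d + 1)) ^ 2 ≤
      sampleVar (x t0) - sampleVar (x t1) := by
    rw [Finset.mul_sum]
    refine (Finset.sum_le_sum hstep).trans (le_of_eq ?_)
    have := Finset.sum_Ico_sub (fun t => sampleVar (x t)) h01
    rw [← neg_inj, ← Finset.sum_neg_distrib]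
    simpa using this
  have hcover : ∑ d ∈ Finset.range (n - 1), (Y d - Y (d + 1)) ^ 2 ≤
      ∑ t ∈ Finset.Ico t0 t1, ∑ d ∈ D t, (Y d - Y (d + 1)) ^ 2 := by
    simp_rw [D, Finset.sum_filter]
    rw [Finset.sum_comm]
    refine Finset.sum_le_sum fun d hd => ?_
    have hd := Finset.mem_range.1 hd
    have hnn : ∀ t ∈ Finset.Ico t0 t1, 0 ≤ if Crosses (A t) r d ∧
        ∀ s, t0 ≤ s → s < t → ¬ Crosses (A s) r d then (Y d - Y (d + 1)) ^ 2 else 0 := by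
      intro t _; split_ifs
      · positivity
      · exact le_rfl
    rcases hc ⟨d, by omega⟩ (by simp; omega) with h | ⟨t, h1, h2, i, j, hi, hj, hij⟩
    · have : Y d = Y (d + 1) := by
        have e1 : min d (n - 1) = d := by omega
        have e2 : min (d + 1) (n - 1) = d + 1 := by omega
        simpa [Y, e1, e2] using h
      refine le_trans (le_of_eq ?_) (Finset.sum_nonneg hnn)
      rw [this]; ring
    · have hex : ∃ t, t0 ≤ t ∧ Crosses (A t) r d :=
        ⟨t, h1, σ i, σ j, by simpa [r, Fin.le_def] using hi, by simpa [r, Fin.lt_def] using hj, hij⟩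
      have hm := Nat.find_spec hex
      have hmin := fun s (hs : s < Nat.find hex) => Nat.find_min hex hs
      have hle : Nat.find hex ≤ t := Nat.find_min' hex
        ⟨h1, σ i, σ j, by simpa [r, Fin.le_def] using hi, by simpa [r, Fin.lt_def] using hj, hij⟩
      have := Finset.single_le_sum hnn (Finset.mem_Ico.2 ⟨hm.1, lt_of_le_of_lt hle h2⟩)
      rwa [if_pos ⟨hm.2, fun s hs1 hs2 hs3 => hmin s hs2 ⟨hs1, hs3⟩⟩] at this
  have hVle : sampleVar (x t0) ≤ (n : ℝ) ^ 2 * ∑ d ∈ Finset.range (n - 1), (Y d - Y (d + 1)) ^ 2 := by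
    have hR : (Y 0 - Y (n - 1)) ^ 2 ≤ n * ∑ d ∈ Finset.range (n - 1), (Y d - Y (d + 1)) ^ 2 := by
      rw [← Finset.sum_range_sub' Y (n - 1)]
      refine sq_sum_le_card_mul_sum_sq.trans ?_
      refine mul_le_mul_of_nonneg_right ?_ (Finset.sum_nonneg fun d _ => sq_nonneg _)
      rw [Finset.card_range]
      exact_mod_cast Nat.sub_le n 1
    calc sampleVar (x t0) ≤ ∑ i, (x t0 i - Y (n - 1)) ^ 2 := sampleVar_le _ hn _
      _ ≤ ∑ i : Fin n, (Y 0 - Y (n - 1)) ^ 2 := by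
          refine Finset.sum_le_sum fun i _ => ?_
          rw [hYr i]
          have b1 := hY (Nat.zero_le (r i))
          have b2 := hY (show r i ≤ n - 1 by have : r i < n := (σ.symm i).2; omega)
          apply pow_le_pow_left₀ <;> linarith
      _ = n * (Y 0 - Y (n - 1)) ^ 2 := by simp
      _ ≤ n * (n * ∑ d ∈ Finset.range (n - 1), (Y d - Y (d + 1)) ^ 2) :=
          mul_le_mul_of_nonneg_left hR (Nat.cast_nonneg n)
      _ = _ := by ring
  have hn' : (0 : ℝ) < n := by exact_mod_cast hn
  rw [le_div_iff₀ hV]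
  refine le_trans ?_ htot
  calc η / (2 * (n : ℝ) ^ 2) * sampleVar (x t0)
      ≤ η / (2 * (n : ℝ) ^ 2) *
        ((n : ℝ) ^ 2 * ∑ d ∈ Finset.range (n - 1), (Y d - Y (d + 1)) ^ 2) :=
        mul_le_mul_of_nonneg_left hVle (by positivity)
    _ = η / 2 * ∑ d ∈ Finset.range (n - 1), (Y d - Y (d + 1)) ^ 2 := by
        field_simp
    _ ≤ _ := mul_le_mul_of_nonneg_left hcover (by positivity)
end

section
/- Let n ≥ 2 and let x ∈ ℝⁿ satisfy x_1 ≥ x_2 ≥ ⋯ ≥ x_n, Σ_{i=1}^n x_i = 0, and Σ_{i=1}^n x_i² = 1. Then Σ_{i=1}^{n−1} (x_i − x_{i+1})² ≥ 1/n². -/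
open Matrix Finset Real Filter

/-- If `x_1 ≥ ⋯ ≥ x_n`, `Σ x_i = 0` and `Σ x_i² = 1`, then
`Σ_{i=1}^{n-1} (x_i - x_{i+1})² ≥ 1/n²`. -/
theorem stmt6 {n : ℕ} (hn : 2 ≤ n) (x : Fin n → ℝ) (hord : Antitone x)
    (hsum : ∑ i, x i = 0) (hsq : ∑ i, x i ^ 2 = 1) :
    1 / (n : ℝ) ^ 2 ≤ sumSqDiff x := by
  have hn0 : 0 < n := by omega
  have hnR : (0 : ℝ) < n := by exact_mod_cast hn0
  let y : ℕ → ℝ := fun k => x ⟨min k (n - 1), by omega⟩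
  have hD : sumSqDiff x = ∑ k ∈ Finset.range n, (y k - y (k + 1)) ^ 2 := by
    rw [Finset.sum_range]
    unfold sumSqDiff
    refine Finset.sum_congr rfl fun i _ => ?_
    have hi := i.isLt
    have h1 : y (i : ℕ) = x i := by
      show x _ = x i
      congr 1
      apply Fin.ext
      show min (i : ℕ) (n - 1) = i
      omega
    split_ifs with h
    · have h2 : y ((i : ℕ) + 1) = x ⟨(i : ℕ) + 1, h⟩ := by
        show x _ = x _
        congr 1
        apply Fin.ext
        show min ((i : ℕ) + 1) (n - 1) = (i : ℕ) + 1
        omega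
      rw [h1, h2]
    · have h2 : y ((i : ℕ) + 1) = x i := by
        show x _ = x _
        congr 1
        apply Fin.ext
        show min ((i : ℕ) + 1) (n - 1) = (i : ℕ)
        omega
      rw [h1, h2]
      ring
  have hcs := sq_sum_le_card_mul_sum_sq (s := Finset.range n) (f := fun k => y k - y (k + 1))
  rw [Finset.sum_range_sub', Finset.card_range, ← hD] at hcs
  have hub : ∀ i, x i ≤ y 0 := fun i => hord (by
    show min 0 (n - 1) ≤ (i : ℕ)
    omega)
  have hlb : ∀ i, y n ≤ x i := fun i => hord (by
    have hi := i.isLt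
    show (i : ℕ) ≤ min n (n - 1)
    omega)
  have h0 : 0 ≤ y 0 := by
    have h := Finset.sum_le_sum (s := Finset.univ) fun i _ => hub i
    rw [hsum] at h
    simp only [Finset.sum_const, Finset.card_univ, Fintype.card_fin, nsmul_eq_mul] at h
    exact nonneg_of_mul_nonneg_right h hnR
  have h1 : y n ≤ 0 := by
    have h := Finset.sum_le_sum (s := Finset.univ) fun i _ => hlb i
    rw [hsum] at h
    simp only [Finset.sum_const, Finset.card_univ, Fintype.card_fin, nsmul_eq_mul] at h
    by_contra hc
    push Not at hc
    have := mul_pos hnR hc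
    linarith
  have h2 : ∀ i, x i ^ 2 ≤ n * sumSqDiff x := fun i => by
    refine le_trans ?_ hcs
    have := hub i
    have := hlb i
    apply sq_le_sq'
    · linarith
    · linarith
  have h := Finset.sum_le_sum (s := Finset.univ) fun i _ => h2 i
  rw [hsq] at h
  simp only [Finset.sum_const, Finset.card_univ, Fintype.card_fin, nsmul_eq_mul] at h
  rw [div_le_iff₀ (by positivity)]
  linarith
end

section
/- There exist constants c > 0 and n₀ with the following property. For any n ≥ n₀, integer B ≥ 1, η ∈ (0, 1/2), and ε ∈ (0,1), there exist a sequence of n×n matrices A(k), k ≥ 0, each doubly stochastic with positive diagonal entries whose positive entries are all at least η and such that for every k the directed graph with edge set E(A(kB)) ∪ E(A(kB+1)) ∪ ⋯ ∪ E(A((k+1)B−1)) is strongly connected, and an initial vector x(0) ∈ ℝⁿ with V(x(0)) > 0, such that for the sequence x(k+1) = A(k)x(k), any k with V(x(k)) ≤ ε V(x(0)) satisfies k ≥ c (n²/η) B log(1/ε). -/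
open Matrix Finset Real Filter

lemma aux_var_s8 {n : ℕ} (hn : 0 < n) (w : ℂ) (hw : w ^ n = 1) (h1 : w ≠ 1) (h2 : w ^ 2 ≠ 1)
    (hnorm : ‖w‖ = 1) (a : ℂ) :
    sampleVar (fun i : Fin n => (a * w ^ (i : ℕ)).re) = n / 2 * Complex.normSq a := by
  have hs : ∀ v : ℂ, v ^ n = 1 → v ≠ 1 → ∑ i : Fin n, v ^ (i : ℕ) = 0 := by
    intro v hv hv1
    rw [Fin.sum_univ_eq_sum_range (fun i => v ^ i) n, geom_sum_eq hv1, hv]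
    simp
  have hz : ∑ i : Fin n, (a * w ^ (i : ℕ)).re = 0 := by
    rw [← Complex.re_sum, ← Finset.mul_sum, hs w hw h1]
    simp
  have hsq : ∀ z : ℂ, z.re ^ 2 = (Complex.normSq z + (z ^ 2).re) / 2 := by
    intro z
    rw [Complex.normSq_apply, pow_two z, Complex.mul_re]
    ring
  have hz2 : ∑ i : Fin n, ((a * w ^ (i : ℕ)) ^ 2).re = 0 := by
    have : ∀ i : Fin n, (a * w ^ (i : ℕ)) ^ 2 = a ^ 2 * (w ^ 2) ^ (i : ℕ) := by
      intro i
      rw [mul_pow, ← pow_mul, ← pow_mul, mul_comm 2]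
    simp_rw [this]
    rw [← Complex.re_sum, ← Finset.mul_sum, hs (w ^ 2) (by rw [← pow_mul, mul_comm, pow_mul, hw, one_pow]) h2]
    simp
  have hns : ∀ i : Fin n, Complex.normSq (a * w ^ (i : ℕ)) = Complex.normSq a := by
    intro i
    rw [Complex.normSq_mul, Complex.normSq_eq_norm_sq (w ^ (i : ℕ)), norm_pow, hnorm]
    simp
  unfold sampleVar avgVec
  rw [hz]
  simp only [zero_div, sub_zero, hsq, hns]
  rw [← Finset.sum_div, Finset.sum_add_distrib, hz2]
  simp
  ring

noncomputable def cycM (n : ℕ) (η : ℝ) : Matrix (Fin (n + 1)) (Fin (n + 1)) ℝ :=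
  fun i j => (1 - η) * (if j = i then 1 else 0) + η * (if j = i + 1 then 1 else 0)

lemma cycM_good (n : ℕ) (η : ℝ) (h0 : 0 < η) (h1 : η < 1 / 2) : GoodWeights η (cycM n η) := by
  refine ⟨⟨?_, ?_, ?_⟩, ?_, ?_⟩
  · intro i j
    unfold cycM
    split_ifs <;> linarith
  · intro i
    simp [cycM, Finset.sum_add_distrib, ← Finset.mul_sum]
  · intro j
    have : ∀ i : Fin (n + 1), (j = i + 1) ↔ (j - 1 = i) := fun i => by rw [sub_eq_iff_eq_add]
    simp [cycM, Finset.sum_add_distrib, ← Finset.mul_sum, this]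
  · intro i
    unfold cycM
    rw [if_pos rfl]
    split_ifs <;> linarith
  · intro i j
    unfold cycM
    split_ifs <;> intro h <;> linarith

lemma one_good (n : ℕ) (η : ℝ) (h1 : η < 1 / 2) :
    GoodWeights η (1 : Matrix (Fin (n + 1)) (Fin (n + 1)) ℝ) := by
  refine ⟨⟨?_, ?_, ?_⟩, ?_, ?_⟩
  · intro i j
    rw [Matrix.one_apply]
    split_ifs <;> norm_num
  · intro i
    simp [Matrix.one_apply]
  · intro j
    simp [Matrix.one_apply]
  · intro i
    simp
  · intro i j
    rw [Matrix.one_apply]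
    split_ifs <;> intro h <;> linarith

lemma cyc_step (n : ℕ) (η : ℝ) (w a : ℂ) (hw : w ^ (n + 1) = 1) :
    (cycM n η).mulVec (fun i => (a * w ^ (i : ℕ)).re)
      = fun i : Fin (n + 1) => (((1 - η : ℂ) + η * w) * a * w ^ (i : ℕ)).re := by
  funext i
  have hv : w ^ ((i + 1 : Fin (n + 1)) : ℕ) = w ^ (i : ℕ) * w := by
    rw [Fin.val_add_one]
    split_ifs with h
    · rw [h, Fin.val_last, ← pow_succ, hw, pow_zero]
    · rw [pow_succ]
  have : (cycM n η).mulVec (fun i => (a * w ^ (i : ℕ)).re) i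
      = (1 - η) * (a * w ^ (i : ℕ)).re + η * (a * w ^ ((i + 1 : Fin (n + 1)) : ℕ)).re := by
    simp [Matrix.mulVec, dotProduct, cycM, add_mul, Finset.sum_add_distrib, mul_assoc,
      -Complex.mul_re, ← Finset.mul_sum]
  rw [this, hv, ← Complex.re_ofReal_mul, ← Complex.re_ofReal_mul, ← Complex.add_re]
  congr 1
  push_cast
  ring

lemma cyc_conn (n : ℕ) (r : Fin (n + 1) → Fin (n + 1) → Prop) (h : ∀ i, r (i + 1) i)
    (u v : Fin (n + 1)) : Relation.ReflTransGen r u v := by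
  have key : ∀ j : ℕ, Relation.ReflTransGen r (v + Fin.ofNat (n + 1) j) v := by
    intro j
    induction j with
    | zero => simp; exact Relation.ReflTransGen.refl
    | succ j ih =>
      refine Relation.ReflTransGen.head ?_ ih
      have e : Fin.ofNat (n + 1) (j + 1) = Fin.ofNat (n + 1) j + 1 := by
        apply Fin.ext
        simp [Fin.ofNat, Fin.val_add]
      rw [e, ← add_assoc]
      exact h _
  have := key (u - v : Fin (n + 1)).val
  rwa [Fin.ofNat_val_eq_self, add_sub_cancel] at this

lemma log_bound (r ε : ℝ) (m : ℕ) (hr : 1 / 2 ≤ r) (hε : 0 < ε) (h : r ^ m ≤ ε) :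
    Real.log (1 / ε) ≤ m * (2 * (1 - r)) ∨ 1 < r := by
  by_cases h1 : 1 < r
  · exact Or.inr h1
  left
  push Not at h1
  have hr0 : 0 < r := by linarith
  have e1 : Real.log (1 / ε) = - Real.log ε := by rw [one_div, Real.log_inv]
  have e2 : m * Real.log r ≤ Real.log ε := by
    rw [← Real.log_pow]
    exact Real.log_le_log (by positivity) h
  have e3 : - Real.log r ≤ 2 * (1 - r) := by
    have := Real.one_sub_inv_le_log_of_pos hr0
    have h4 : r⁻¹ - 1 ≤ 2 * (1 - r) := by
      have : r⁻¹ ≤ 2 := by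
        rw [inv_le_comm₀ hr0 (by norm_num)]; linarith
      have h5 : r⁻¹ - 1 = r⁻¹ * (1 - r) := by field_simp
      rw [h5]
      exact mul_le_mul_of_nonneg_right this (by linarith)
    linarith
  rw [e1]
  have : (m : ℝ) * (- Real.log r) ≤ m * (2 * (1 - r)) :=
    mul_le_mul_of_nonneg_left e3 (by positivity)
  linarith

/-- tightness of the convergence time bound. -/
theorem stmt8 :
    ∃ c : ℝ, 0 < c ∧ ∃ n₀ : ℕ,
      ∀ n : ℕ, n₀ ≤ n → ∀ B : ℕ, 1 ≤ B → ∀ η : ℝ, 0 < η → η < 1 / 2 →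
        ∀ ε : ℝ, 0 < ε → ε < 1 →
          ∃ A : ℕ → Matrix (Fin n) (Fin n) ℝ,
            (∀ k, GoodWeights η (A k)) ∧ (∀ k, BlockConnected A B k) ∧
              ∃ x₀ : Fin n → ℝ, 0 < sampleVar x₀ ∧
                ∀ x : ℕ → Fin n → ℝ, x 0 = x₀ →
                  (∀ k, x (k + 1) = (A k).mulVec (x k)) →
                    ∀ k : ℕ, sampleVar (x k) ≤ ε * sampleVar x₀ →
                      c * ((n : ℝ) ^ 2 / η) * B * Real.log (1 / ε) ≤ k := by
  refine ⟨1 / 80, by norm_num, 7, ?_⟩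
  intro n' hn B hB η h0 h1 ε he0 he1
  obtain ⟨n, rfl⟩ : ∃ n, n' = n + 1 := ⟨n' - 1, by omega⟩
  obtain ⟨N, hN⟩ : ∃ N : ℝ, N = ((n + 1 : ℕ) : ℝ) := ⟨_, rfl⟩
  have hN7 : 7 ≤ N := by rw [hN]; exact_mod_cast hn
  obtain ⟨w, hwdef⟩ : ∃ w : ℂ, w = Complex.exp (2 * π * Complex.I / (n + 1 : ℕ)) := ⟨_, rfl⟩
  have hprim : IsPrimitiveRoot w (n + 1) := by
    rw [hwdef]; exact Complex.isPrimitiveRoot_exp (n + 1) (by omega)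
  have hw := hprim.pow_eq_one
  have hw1 : w ≠ 1 := hprim.ne_one (by omega)
  have hw2 : w ^ 2 ≠ 1 := hprim.pow_ne_one_of_pos_of_lt (by norm_num) (by omega)
  have hnorm : ‖w‖ = 1 := hprim.norm'_eq_one (by omega)
  have hwre : w.re = Real.cos (2 * π / N) := by
    have : (2 * π * Complex.I / (n + 1 : ℕ) : ℂ) = ((2 * π / N : ℝ) : ℂ) * Complex.I := by
      rw [hN]; push_cast; ring
    rw [hwdef, this, Complex.exp_ofReal_mul_I_re]
  have hwn : w.re * w.re + w.im * w.im = 1 := by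
    rw [← Complex.normSq_apply, Complex.normSq_eq_norm_sq, hnorm]; norm_num
  obtain ⟨l, hl⟩ : ∃ l : ℂ, l = (1 - η : ℂ) + η * w := ⟨_, rfl⟩
  have hns : Complex.normSq l = 1 - 2 * η * (1 - η) * (1 - w.re) := by
    rw [hl, Complex.normSq_apply]
    simp
    linear_combination η ^ 2 * hwn
  have hcos : 1 - w.re ≤ 20 / N ^ 2 := by
    rw [hwre]
    have a1 := Real.one_sub_sq_div_two_le_cos (x := 2 * π / N)
    have a2 : (2 * π / N) ^ 2 / 2 ≤ 20 / N ^ 2 := by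
      rw [div_pow, div_div, div_le_div_iff₀ (by positivity) (by positivity)]
      have : π ^ 2 ≤ 10 := by nlinarith [Real.pi_lt_d2, Real.pi_pos]
      have hp : 0 < N ^ 2 := by positivity
      nlinarith
    linarith
  have hcos0 : 0 ≤ 1 - w.re := by rw [hwre]; linarith [Real.cos_le_one (2 * π / N)]
  have hr1 : 1 - Complex.normSq l ≤ 40 * η / N ^ 2 := by
    rw [hns]
    have : 2 * η * (1 - η) * (1 - w.re) ≤ 2 * η * (20 / N ^ 2) := by
      apply mul_le_mul _ hcos hcos0 (by positivity)
      nlinarith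
    calc _ = 2 * η * (1 - η) * (1 - w.re) := by ring
      _ ≤ _ := this
      _ = _ := by ring
  have hr2 : Complex.normSq l ≤ 1 := by
    rw [hns]
    have : 0 ≤ 2 * η * (1 - η) * (1 - w.re) :=
      mul_nonneg (mul_nonneg (by linarith) (by linarith)) hcos0
    linarith
  have hr3 : 1 / 2 ≤ Complex.normSq l := by
    have : 40 * η / N ^ 2 ≤ 1 / 2 := by
      rw [div_le_div_iff₀ (by positivity) (by norm_num)]
      nlinarith
    linarith
  refine ⟨fun k => if B ∣ k + 1 then cycM n η else 1, ?_, ?_,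
    fun i => ((1 : ℂ) * w ^ (i : ℕ)).re, ?_, ?_⟩
  · intro k
    dsimp only
    split_ifs
    · exact cycM_good n η h0 h1
    · exact one_good n η h1
  · intro k u v
    apply cyc_conn
    intro i
    refine ⟨k * B + (B - 1), by omega, ?_, ?_⟩
    · rw [add_mul]; omega
    · have : B ∣ k * B + (B - 1) + 1 := ⟨k + 1, by rw [mul_add, mul_comm B k]; omega⟩
      simp only [this, if_true]
      unfold cycM
      rw [if_pos rfl]
      split_ifs <;> linarith
  · rw [aux_var_s8 (by omega) w hw hw1 hw2 hnorm]
    simp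
    positivity
  · intro x hx0 hx k hk
    have hform : ∀ k, x k = fun i : Fin (n + 1) => (l ^ (k / B) * w ^ (i : ℕ)).re := by
      intro k
      induction k with
      | zero => rw [hx0]; simp
      | succ k ih =>
        rw [hx, ih, Nat.succ_div]
        by_cases hd : B ∣ k + 1
        · simp only [hd, if_true]
          rw [cyc_step n η w _ hw, ← hl]
          funext i
          rw [pow_succ']
        · simp only [hd, if_false, Matrix.one_mulVec, add_zero]
    rw [hform k, aux_var_s8 (by omega) w hw hw1 hw2 hnorm, aux_var_s8 (by omega) w hw hw1 hw2 hnorm,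
      map_pow, map_one, mul_one, mul_comm ε, ← hN] at hk
    have hk' : Complex.normSq l ^ (k / B) ≤ ε := le_of_mul_le_mul_left hk (by positivity)
    rcases log_bound _ ε _ hr3 he0 hk' with hb | hb
    swap
    · linarith
    have hm : ((k / B : ℕ) : ℝ) * B ≤ k := by exact_mod_cast Nat.div_mul_le_self k B
    have hb2 : Real.log (1 / ε) ≤ ((k / B : ℕ) : ℝ) * (2 * (40 * η / N ^ 2)) :=
      hb.trans (mul_le_mul_of_nonneg_left (by linarith) (by positivity))
    rw [← hN]
    calc 1 / 80 * (N ^ 2 / η) * B * Real.log (1 / ε)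
        ≤ 1 / 80 * (N ^ 2 / η) * B * (((k / B : ℕ) : ℝ) * (2 * (40 * η / N ^ 2))) :=
          mul_le_mul_of_nonneg_left hb2 (by positivity)
      _ = ((k / B : ℕ) : ℝ) * B := by
          have : N ≠ 0 := by positivity
          field_simp
          ring
      _ ≤ k := hm
end

section
/- Let η > 0, B ≥ 1, and Q a positive integer. Let A(k), k ≥ 0, be a sequence of n×n doubly stochastic matrices with positive diagonal entries whose positive entries are all at least η, and such that for every k the directed graph with edge set E(A(kB)) ∪ ⋯ ∪ E(A((k+1)B−1)) is strongly connected. Let x(0) ∈ ℝⁿ have all components equal to multiples of 1/Q, set U = max_i x_i(0), L = min_i x_i(0), K = (U − L)Q, and let the sequence x(k) evolve by the quantized update x_i(k+1) = ⌊Σ_{j=1}^n a_{ij}(k) x_j(k)⌋_{1/Q}. Then for every k ≥ nBK, all components of x(k) are equal. -/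
open Matrix Finset Real Filter

section helpers

variable {n : ℕ} {η : ℝ} {A : ℕ → Matrix (Fin n) (Fin n) ℝ} {z : ℕ → Fin n → ℤ}

theorem aux_upper (hA : ∀ k, GoodWeights η (A k))
    (hz : ∀ t i, z (t + 1) i = ⌊∑ j, A t i j * (z t j : ℝ)⌋) (M : ℤ) (t : ℕ)
    (h : ∀ j, z t j ≤ M) (s : ℕ) (hs : t ≤ s) : ∀ j, z s j ≤ M := by
  induction s, hs using Nat.le_induction with
  | base => exact h
  | succ s _ ih =>
    intro i
    rw [hz]
    have h1 : ∑ j, A s i j * (z s j : ℝ) ≤ M := by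
      calc ∑ j, A s i j * (z s j : ℝ) ≤ ∑ j, A s i j * (M : ℝ) := by
            apply Finset.sum_le_sum
            intro j _
            exact mul_le_mul_of_nonneg_left (by exact_mod_cast ih j) ((hA s).1.1 i j)
        _ = M := by rw [← Finset.sum_mul, (hA s).1.2.1 i, one_mul]
    exact_mod_cast (Int.floor_le _).trans h1

theorem aux_lower (hA : ∀ k, GoodWeights η (A k))
    (hz : ∀ t i, z (t + 1) i = ⌊∑ j, A t i j * (z t j : ℝ)⌋) (M : ℤ) (t : ℕ)
    (h : ∀ j, M ≤ z t j) (s : ℕ) (hs : t ≤ s) : ∀ j, M ≤ z s j := by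
  induction s, hs using Nat.le_induction with
  | base => exact h
  | succ s _ ih =>
    intro i
    rw [hz, Int.le_floor]
    calc (M : ℝ) = ∑ j, A s i j * (M : ℝ) := by
          rw [← Finset.sum_mul, (hA s).1.2.1 i, one_mul]
      _ ≤ _ := by
          apply Finset.sum_le_sum
          intro j _
          exact mul_le_mul_of_nonneg_left (by exact_mod_cast ih j) ((hA s).1.1 i j)

theorem aux_strict (hA : ∀ k, GoodWeights η (A k))
    (hz : ∀ t i, z (t + 1) i = ⌊∑ j, A t i j * (z t j : ℝ)⌋) (M : ℤ) (t : ℕ)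
    (h : ∀ j, z t j ≤ M) (i j : Fin n) (hi : z (t + 1) i = M) (hp : 0 < A t i j) :
    z t j = M := by
  by_contra hne
  have hlt : z t j < M := lt_of_le_of_ne (h j) hne
  have h1 : ∑ j, A t i j * (z t j : ℝ) < ∑ j, A t i j * (M : ℝ) := by
    apply Finset.sum_lt_sum
    · intro j _
      exact mul_le_mul_of_nonneg_left (by exact_mod_cast h j) ((hA t).1.1 i j)
    · exact ⟨j, Finset.mem_univ _, mul_lt_mul_of_pos_left (by exact_mod_cast hlt) hp⟩
  rw [← Finset.sum_mul, (hA t).1.2.1 i, one_mul] at h1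
  have h2 := Int.floor_lt.2 h1
  rw [← hz, hi] at h2
  exact lt_irrefl _ h2

theorem aux_anti (hA : ∀ k, GoodWeights η (A k))
    (hz : ∀ t i, z (t + 1) i = ⌊∑ j, A t i j * (z t j : ℝ)⌋) (M : ℤ) (t : ℕ)
    (h : ∀ j, z t j ≤ M) (s : ℕ) (hs : t ≤ s) (i : Fin n) (hi : z s i = M) :
    z t i = M := by
  induction s, hs using Nat.le_induction with
  | base => exact hi
  | succ s hs ih =>
    exact ih (aux_strict hA hz M s (aux_upper hA hz M t h s hs) i i hi ((hA s).2.1 i))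

theorem aux_cons (hA : ∀ k, GoodWeights η (A k))
    (hz : ∀ t i, z (t + 1) i = ⌊∑ j, A t i j * (z t j : ℝ)⌋) (t : ℕ)
    (h : ∀ i j, z t i = z t j) (s : ℕ) (hs : t ≤ s) (i j : Fin n) : z s i = z s j := by
  have h1 := aux_upper hA hz (z t i) t (fun j => (h j i).le) s hs
  have h2 := aux_lower hA hz (z t i) t (fun j => (h i j).le) s hs
  have := h1 i; have := h1 j; have := h2 i; have := h2 j
  omega

theorem aux_block (hA : ∀ k, GoodWeights η (A k))
    (hz : ∀ t i, z (t + 1) i = ⌊∑ j, A t i j * (z t j : ℝ)⌋) {B : ℕ}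
    (hconn : ∀ k, BlockConnected A B k) (M : ℤ) (b : ℕ)
    (h : ∀ j, z (b * B) j ≤ M) (u v : Fin n) (hu : z (b * B) u ≠ M)
    (hv : z ((b + 1) * B) v = M) :
    (univ.filter fun i => z ((b + 1) * B) i = M).card
      < (univ.filter fun i => z (b * B) i = M).card := by
  have hle : b * B ≤ (b + 1) * B := Nat.mul_le_mul_right _ (Nat.le_succ _)
  have hsub : (univ.filter fun i => z ((b + 1) * B) i = M) ⊆
      (univ.filter fun i => z (b * B) i = M) := by
    intro i hi
    simp only [mem_filter, mem_univ, true_and] at hi ⊢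
    exact aux_anti hA hz M _ h _ hle i hi
  by_contra hc
  have heq := Finset.eq_of_subset_of_card_le hsub (not_lt.1 hc)
  have hkey : ∀ i, z (b * B) i = M → z ((b + 1) * B) i = M := by
    intro i hi
    have : i ∈ (univ.filter fun i => z (b * B) i = M) := by simp [hi]
    rw [← heq] at this
    simpa using this
  have hpath : ∀ w, Relation.ReflTransGen
      (fun a c => ∃ t, b * B ≤ t ∧ t < (b + 1) * B ∧ 0 < A t c a) u w →
      z (b * B) w ≠ M := by
    intro w hw
    induction hw with
    | refl => exact hu
    | tail _ hs ih =>
      obtain ⟨t, ht1, ht2, hp⟩ := hs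
      intro hc
      apply ih
      have hup := aux_upper hA hz M _ h
      have h2 := aux_anti hA hz M (t + 1) (hup (t + 1) (by omega)) _ ht2 _ (hkey _ hc)
      have h3 := aux_strict hA hz M t (hup t ht1) _ _ h2 hp
      exact aux_anti hA hz M _ h t ht1 _ h3
  exact hpath v (hconn b u v) (aux_anti hA hz M _ h _ hle v hv)

theorem aux_main (hn : 1 ≤ n) (hA : ∀ k, GoodWeights η (A k))
    (hz : ∀ t i, z (t + 1) i = ⌊∑ j, A t i j * (z t j : ℝ)⌋) {B : ℕ}
    (hconn : ∀ k, BlockConnected A B k) (u l : ℤ)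
    (hu : ∀ j, z 0 j ≤ u) (b : ℕ) :
    (∀ i j, z (b * B) i = z (b * B) j) ∨
      ∃ M i, z (b * B) i = M ∧ (∀ j, z (b * B) j ≤ M) ∧
      (n : ℤ) * (M - l) + (univ.filter fun i => z (b * B) i = M).card + b
        ≤ n * (u - l) + n := by
  have hne : Nonempty (Fin n) := ⟨⟨0, hn⟩⟩
  have hcard : ∀ (s : Finset (Fin n)), (s.card : ℤ) ≤ n := by
    intro s
    have := Finset.card_le_univ s
    simp only [Fintype.card_fin] at this
    exact_mod_cast this
  induction b with
  | zero =>
    right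
    obtain ⟨i, hi⟩ := Finite.exists_max (z (0 * B))
    refine ⟨_, i, rfl, hi, ?_⟩
    have h1 := hcard (univ.filter fun j => z (0 * B) j = z (0 * B) i)
    have h2 : z (0 * B) i ≤ u := by rw [zero_mul]; exact hu i
    have h3 : (n : ℤ) * (z (0 * B) i - l) ≤ n * (u - l) :=
      mul_le_mul_of_nonneg_left (by omega) (by positivity)
    push_cast
    linarith
  | succ b ih =>
    have hle : b * B ≤ (b + 1) * B := Nat.mul_le_mul_right _ (Nat.le_succ _)
    rcases ih with ih | ⟨M, i, hi, hM, hpot⟩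
    · left
      exact aux_cons hA hz _ ih _ hle
    by_cases hc : ∀ j, z (b * B) j = M
    · left
      exact aux_cons hA hz _ (fun i j => (hc i).trans (hc j).symm) _ hle
    push Not at hc
    obtain ⟨w, hw⟩ := hc
    right
    obtain ⟨v, hv⟩ := Finite.exists_max (z ((b + 1) * B))
    refine ⟨_, v, rfl, hv, ?_⟩
    have hvM := aux_upper hA hz M _ hM _ hle v
    rcases hvM.eq_or_lt with he | hlt
    · have hbl := aux_block hA hz hconn M b hM w v hw he
      rw [he]
      push_cast
      zify at hbl
      linarith
    · have h1 := hcard (univ.filter fun j => z ((b + 1) * B) j = z ((b + 1) * B) v)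
      have h2 : 0 < (univ.filter fun j => z (b * B) j = M).card :=
        Finset.card_pos.2 ⟨i, by simp [hi]⟩
      have h3 : (n : ℤ) * (z ((b + 1) * B) v - l) ≤ n * (M - 1 - l) :=
        mul_le_mul_of_nonneg_left (by omega) (by positivity)
      push_cast
      zify at h2
      linarith

end helpers

/-- For the quantized update with initial values that are multiples of `1/Q`,
all components of `x(k)` are equal once `k ≥ nBK`, where `K = (U-L)Q`. -/
theorem stmt10 {n : ℕ} (hn : 1 ≤ n) (η : ℝ) (hη : 0 < η) (B : ℕ) (hB : 1 ≤ B)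
    (Q : ℕ) (hQ : 0 < Q)
    (A : ℕ → Matrix (Fin n) (Fin n) ℝ) (hA : ∀ k, GoodWeights η (A k))
    (hconn : ∀ k, BlockConnected A B k)
    (x : ℕ → Fin n → ℝ)
    (hquant : ∀ i, ∃ m : ℤ, x 0 i = (m : ℝ) / Q)
    (hx : ∀ k i, x (k + 1) i = qfloor Q ((A k).mulVec (x k) i))
    (U L : ℝ) (hU : IsGreatest (Set.range (x 0)) U) (hL : IsLeast (Set.range (x 0)) L)
    (k : ℕ) (hk : (n : ℝ) * B * ((U - L) * Q) ≤ k) :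
    ∀ i j, x k i = x k j := by
  have hQ' : (Q : ℝ) ≠ 0 := by positivity
  have hQp : (0 : ℝ) < Q := by positivity
  have hex : ∀ t i, ∃ m : ℤ, x t i = (m : ℝ) / Q := by
    intro t
    cases t with
    | zero => exact hquant
    | succ t => exact fun i => ⟨_, hx t i⟩
  choose z hzx using hex
  have hz : ∀ t i, z (t + 1) i = ⌊∑ j, A t i j * (z t j : ℝ)⌋ := by
    intro t i
    have h1 := hx t i
    rw [hzx, qfloor, div_left_inj' hQ'] at h1
    have h2 : (Q : ℝ) * (A t).mulVec (x t) i = ∑ j, A t i j * (z t j : ℝ) := by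
      simp only [Matrix.mulVec, dotProduct, Finset.mul_sum]
      apply Finset.sum_congr rfl
      intro j _
      rw [hzx]
      field_simp
    rw [h2] at h1
    exact_mod_cast h1
  obtain ⟨⟨iu, hiu⟩, hUb⟩ := hU
  obtain ⟨⟨il, hil⟩, hLb⟩ := hL
  have hu : ∀ j, z 0 j ≤ z 0 iu := by
    intro j
    have := hUb ⟨j, rfl⟩
    rw [← hiu, hzx, hzx, div_le_div_iff_of_pos_right hQp] at this
    exact_mod_cast this
  have hl : ∀ j, z 0 il ≤ z 0 j := by
    intro j
    have := hLb ⟨j, rfl⟩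
    rw [← hil, hzx, hzx, div_le_div_iff_of_pos_right hQp] at this
    exact_mod_cast this
  obtain ⟨K, hK⟩ := Int.eq_ofNat_of_zero_le (sub_nonneg.2 (hl iu))
  have hKr : (U - L) * Q = (K : ℝ) := by
    have : ((z 0 iu - z 0 il : ℤ) : ℝ) = ((K : ℤ) : ℝ) := by rw [hK]
    push_cast at this
    rw [← hiu, ← hil, hzx, hzx, ← this]
    field_simp
  rw [hKr] at hk
  have hk' : n * K * B ≤ k := by
    have : n * B * K ≤ k := by exact_mod_cast hk
    calc n * K * B = n * B * K := by ring
      _ ≤ k := this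
  have hfin : ∀ i j, z (n * K * B) i = z (n * K * B) j := by
    rcases aux_main hn hA hz hconn (z 0 iu) (z 0 il) hu (n * K) with h | ⟨M, i, hi, hM, hpot⟩
    · exact h
    have hlow := aux_lower hA hz (z 0 il) 0 hl (n * K * B) (Nat.zero_le _)
    have h2 : 0 < (univ.filter fun j => z (n * K * B) j = M).card :=
      Finset.card_pos.2 ⟨i, by simp [hi]⟩
    zify at h2
    rw [hK] at hpot
    push_cast at hpot
    have h3 : (n : ℤ) * (M - z 0 il) < n * 1 := by linarith
    have h4 : M - z 0 il < 1 := lt_of_mul_lt_mul_left h3 (by positivity)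
    intro a c
    have := hlow a; have := hlow c; have := hM a; have := hM c
    omega
  intro i j
  rw [hzx, hzx, aux_cons hA hz _ hfin k hk' i j]
end

section
/- For every x ∈ ℝⁿ (n ≥ 1), V(x) ≤ V̲(x) ≤ 4n V(x), where V(x) = Σ_{i=1}^n (x_i − x̄)² with x̄ = (1/n)Σ_i x_i, and V̲(x) = Σ_{i=1}^n (x_i − m(x))² with m(x) = min_i x_i. -/
open Matrix Finset Real Filter

/-- `V(x) ≤ V̲(x) ≤ 4n V(x)`. -/
theorem stmt12 {n : ℕ} (hn : 1 ≤ n) (x : Fin n → ℝ) :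
    sampleVar x ≤ underVar x ∧ underVar x ≤ 4 * (n : ℝ) * sampleVar x := by
  have hn' : (1 : ℝ) ≤ n := by exact_mod_cast hn
  haveI : Nonempty (Fin n) := ⟨⟨0, hn⟩⟩
  obtain ⟨j, hj⟩ := exists_eq_ciInf_of_finite (f := x)
  have hs : ∑ i, (x i - avgVec x) = 0 := by
    rw [Finset.sum_sub_distrib]
    simp only [Finset.sum_const, Finset.card_univ, Fintype.card_fin, nsmul_eq_mul, avgVec]
    field_simp
    simp
  have key : underVar x = sampleVar x + n * (avgVec x - x j) ^ 2 := by
    have h1 : ∀ i, (x i - ⨅ j, x j) ^ 2 = (x i - avgVec x) ^ 2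
        + (2 * (avgVec x - x j)) * (x i - avgVec x) + (avgVec x - x j) ^ 2 := by
      intro i
      rw [← hj]
      ring
    unfold underVar sampleVar
    rw [Finset.sum_congr rfl (fun i _ => h1 i), Finset.sum_add_distrib, Finset.sum_add_distrib,
      ← Finset.mul_sum, hs]
    simp
  have hle : (avgVec x - x j) ^ 2 ≤ sampleVar x := by
    have h2 : (x j - avgVec x) ^ 2 ≤ sampleVar x :=
      Finset.single_le_sum (f := fun i => (x i - avgVec x) ^ 2)
        (fun i _ => sq_nonneg _) (Finset.mem_univ j)
    linarith [sub_sq_comm (x j) (avgVec x)]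
  have h0 : 0 ≤ (avgVec x - x j) ^ 2 := sq_nonneg _
  rw [key]
  constructor
  · have := mul_nonneg (by linarith : (0 : ℝ) ≤ n) h0
    linarith
  · nlinarith [mul_le_mul_of_nonneg_left hle (by linarith : (0 : ℝ) ≤ n),
      mul_nonneg (by linarith : (0 : ℝ) ≤ n - 1) (h0.trans hle)]
end
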